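/- Every weight 𝕀_n-module is a direct sum of simple weight 𝕀_n-modules; in particular, the category of weight 𝕀_n-modules is a semisimple category. -/

import Mathlib

set_option maxHeartbeats 1000000
set_option synthInstance.maxHeartbeats 400000
set_option linter.unusedSectionVars false

namespace IDO

open scoped TensorProduct

noncomputable section

variable (K : Type*) [Field K] [CharZero K] (n : ℕ)

/-- The polynomial algebra `P_n = K[x_1, …, x_n]`. -/
abbrev P := MvPolynomial (Fin n) K

/-- The multiplication operator `x_i`. -/
def xOp (i : Fin n) : Module.End K (P K n) := LinearMap.mulLeft K (MvPolynomial.X i)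

/-- The partial derivative `∂_i`. -/
def dOp (i : Fin n) : Module.End K (P K n) := (MvPolynomial.pderiv i).toLinearMap

/-- The integration operator `∫_i`, sending `x^α ↦ x^{α+e_i}/(α_i+1)`. -/
def intOp (i : Fin n) : Module.End K (P K n) :=
  ((MvPolynomial.basisMonomials (Fin n) K).constr K)
    (fun α => (((α i : ℕ) : K) + 1)⁻¹ •
      (MvPolynomial.monomial (α + Finsupp.single i 1) (1 : K)))

/-- The algebra of polynomial integro-differential operators `𝕀_n`, as a subalgebra of
`End_K(P_n)` generated by the `x_i`, `∂_i` and `∫_i`. -/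
def InSub : Subalgebra K (Module.End K (P K n)) :=
  Algebra.adjoin K (Set.range (xOp K n) ∪ Set.range (dOp K n) ∪ Set.range (intOp K n))

/-- The algebra `𝕀_n` (as a type, with its canonical ring structure). -/
def In : Type _ := InSub K n

instance : Ring (In K n) := inferInstanceAs (Ring (InSub K n))
instance : Algebra K (In K n) := inferInstanceAs (Algebra K (InSub K n))
instance : Module (In K n) (P K n) := inferInstanceAs (Module (InSub K n) (P K n))
instance : IsScalarTower K (In K n) (P K n) :=
  inferInstanceAs (IsScalarTower K (InSub K n) (P K n))

/-- `x_i` as an element of `𝕀_n`. -/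
def xEl (i : Fin n) : In K n :=
  show InSub K n from
    ⟨xOp K n i, Algebra.subset_adjoin (Set.mem_union_left _ (Set.mem_union_left _ ⟨i, rfl⟩))⟩

/-- `∂_i` as an element of `𝕀_n`. -/
def dEl (i : Fin n) : In K n :=
  show InSub K n from
    ⟨dOp K n i, Algebra.subset_adjoin (Set.mem_union_left _ (Set.mem_union_right _ ⟨i, rfl⟩))⟩

/-- `∫_i` as an element of `𝕀_n`. -/
def intEl (i : Fin n) : In K n :=
  show InSub K n from
    ⟨intOp K n i, Algebra.subset_adjoin (Set.mem_union_right _ ⟨i, rfl⟩)⟩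

/-- `H_i = ∂_i x_i` as an element of `𝕀_n`. -/
def HEl (i : Fin n) : In K n := dEl K n i * xEl K n i

section Modules

variable (M : Type*) [AddCommGroup M] [Module K M] [Module (In K n) M]
  [IsScalarTower K (In K n) M]

/-- The weight space `M_λ = {m | H_i m = λ_i m for all i}`. -/
def weightSpace (lam : Fin n → K) : Submodule K M where
  carrier := {m | ∀ i, HEl K n i • m = lam i • m}
  add_mem' := by
    intro a b ha hb i
    rw [smul_add, ha i, hb i, smul_add]
  zero_mem' := by intro i; simp
  smul_mem' := by
    intro c m hm i
    rw [← smul_comm c (HEl K n i) m, hm i, smul_smul, mul_comm, ← smul_smul]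

private lemma pow_smul_zero_mono {a : In K n} {m : M} {s s' : ℕ}
    (h : (a ^ s) • m = 0) (hle : s ≤ s') : (a ^ s') • m = 0 := by
  obtain ⟨k, rfl⟩ := Nat.exists_eq_add_of_le hle
  rw [add_comm s k, pow_add, mul_smul, h, smul_zero]

/-- The generalized weight space `M^λ = {m | (H_i − λ_i)^N m = 0 for some N and all i}`. -/
def genWeightSpace (lam : Fin n → K) : Submodule K M where
  carrier := {m | ∃ N : ℕ, ∀ i,
    ((HEl K n i - algebraMap K (In K n) (lam i)) ^ N) • m = 0}
  add_mem' := by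
    rintro a b ⟨Na, ha⟩ ⟨Nb, hb⟩
    refine ⟨Na ⊔ Nb, fun i => ?_⟩
    rw [smul_add, pow_smul_zero_mono K n M (ha i) le_sup_left,
      pow_smul_zero_mono K n M (hb i) le_sup_right, add_zero]
  zero_mem' := ⟨0, fun i => smul_zero _⟩
  smul_mem' := by
    rintro c m ⟨N, hN⟩
    exact ⟨N, fun i => by rw [← smul_comm c _ m, hN i, smul_zero]⟩

/-- `M` is a weight module: `M = ⊕_λ M_λ`. -/
def IsWeightModule : Prop :=
  letI := Classical.decEq (Fin n → K)
  DirectSum.IsInternal (fun lam : Fin n → K => weightSpace K n M lam)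

/-- `M` is a generalized weight module: `M = ⊕_λ M^λ`. -/
def IsGenWeightModule : Prop :=
  letI := Classical.decEq (Fin n → K)
  DirectSum.IsInternal (fun lam : Fin n → K => genWeightSpace K n M lam)

/-- The support `Supp(M) = {λ | M^λ ≠ 0}`. -/
def supp : Set (Fin n → K) := {lam | genWeightSpace K n M lam ≠ ⊥}

/-- `M` is an indecomposable `𝕀_n`-module. -/
def IsIndecomposableMod : Prop :=
  Nontrivial M ∧ ∀ p q : Submodule (In K n) M, IsCompl p q → p = ⊥ ∨ q = ⊥

/-- The annihilator of an `𝕀_n`-module, as a set. -/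
def annSet : Set (In K n) := {a | ∀ m : M, a • m = 0}

end Modules

/-- A prime (two-sided) ideal of the noncommutative ring `𝕀_n`, given as a set:
`S ≠ 𝕀_n` and `a 𝕀_n b ⊆ S → a ∈ S ∨ b ∈ S`. -/
def IsPrimeSet (S : Set (In K n)) : Prop :=
  S ≠ Set.univ ∧ ∀ a b : In K n, (∀ r : In K n, a * r * b ∈ S) → a ∈ S ∨ b ∈ S

-- orbits
/-- The `ℤ^n`-orbit of `λ ∈ K^n`. -/
def orbitOf (lam : Fin n → K) : Set (Fin n → K) :=
  {mu | ∀ i, ∃ z : ℤ, mu i - lam i = (z : K)}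

/-- The setoid on `K^n` whose classes are the `ℤ^n`-orbits. -/
def orbitSetoid : Setoid (Fin n → K) where
  r mu nu := ∀ i, ∃ z : ℤ, mu i - nu i = (z : K)
  iseqv := by
    constructor
    · intro x i; exact ⟨0, by simp⟩
    · intro x y h i
      obtain ⟨z, hz⟩ := h i
      exact ⟨-z, by push_cast; linear_combination -hz⟩
    · intro x y z hxy hyz i
      obtain ⟨a, ha⟩ := hxy i
      obtain ⟨b, hb⟩ := hyz i
      exact ⟨a + b, by push_cast; linear_combination ha + hb⟩

/-- `𝔻_Ω = {i | Ω_i = ℤ}` for the orbit `Ω` of `λ`. -/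
def DD (lam : Fin n → K) : Set (Fin n) := {i | ∃ z : ℤ, lam i = (z : K)}

/-- `λ` is the normalized representative of its orbit: integer coordinates are `0`. -/
def IsNormalized (lam : Fin n → K) : Prop := ∀ i, (∃ z : ℤ, lam i = (z : K)) → lam i = 0


-- I_1 specifics
/-- The matrix units `e_{st} = ∫^s ∂^t − ∫^{s+1} ∂^{t+1}` of `𝕀_1`. -/
def eEl1 (s t : ℕ) : In K 1 :=
  intEl K 1 0 ^ s * dEl K 1 0 ^ t - intEl K 1 0 ^ (s + 1) * dEl K 1 0 ^ (t + 1)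

/-- `F = ⊕ K e_{st}`, the unique proper two-sided ideal of `𝕀_1`, here as the left ideal
generated by the `e_{st}` (the two coincide). -/
def Fideal : Submodule (In K 1) (In K 1) :=
  Submodule.span (In K 1) {a | ∃ s t : ℕ, a = eEl1 K s t}

/-- The left ideal `F + 𝕀_1 (H − μ)^s`. -/
def MslIdeal (s : ℕ) (mu : K) : Submodule (In K 1) (In K 1) :=
  Fideal K ⊔ Submodule.span (In K 1) {(HEl K 1 0 - algebraMap K (In K 1) mu) ^ s}

/-- The `𝕀_1`-module `M(s,μ) = 𝕀_1/(F + 𝕀_1 (H − μ)^s)`. -/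
def Msl (s : ℕ) (mu : K) := (In K 1) ⧸ MslIdeal K s mu

instance (s : ℕ) (mu : K) : AddCommGroup (Msl K s mu) :=
  inferInstanceAs (AddCommGroup ((In K 1) ⧸ MslIdeal K s mu))
instance (s : ℕ) (mu : K) : Module (In K 1) (Msl K s mu) :=
  inferInstanceAs (Module (In K 1) ((In K 1) ⧸ MslIdeal K s mu))
instance (s : ℕ) (mu : K) : Module K (Msl K s mu) :=
  inferInstanceAs (Module K ((In K 1) ⧸ MslIdeal K s mu))
instance (s : ℕ) (mu : K) : IsScalarTower K (In K 1) (Msl K s mu) :=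
  inferInstanceAs (IsScalarTower K (In K 1) ((In K 1) ⧸ MslIdeal K s mu))

-- two-sided ideals of I_n
/-- The element `e_{st}(i) ∈ 𝕀_n` built from the `i`-th tensor factor. -/
def eElN (i : Fin n) (s t : ℕ) : In K n :=
  intEl K n i ^ s * dEl K n i ^ t - intEl K n i ^ (s + 1) * dEl K n i ^ (t + 1)

/-- The height one prime `𝔭_i`, the two-sided ideal of `𝕀_n` generated by `F(i)`. -/
def pIdeal (i : Fin n) : TwoSidedIdeal (In K n) :=
  TwoSidedIdeal.span {a | ∃ s t : ℕ, a = eElN K n i s t}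

/-- `𝔞_n(I) = Σ_{i ∈ I} 𝔭_i`. -/
def aIdeal (I : Set (Fin n)) : TwoSidedIdeal (In K n) := ⨆ i ∈ I, pIdeal K n i


-- bundled modules
universe u

/-- A bundled `𝕀_n`-module (with compatible `K`-structure). -/
structure ModN (K : Type u) [Field K] [CharZero K] (n : ℕ) : Type (u + 1) where
  carrier : Type u
  [instAdd : AddCommGroup carrier]
  [instK : Module K carrier]
  [instIn : Module (In K n) carrier]
  [instTower : IsScalarTower K (In K n) carrier]

attribute [instance] ModN.instAdd ModN.instK ModN.instIn ModN.instTower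

/-- The endomorphism of `M_1 ⊗ ⋯ ⊗ M_n` acting by `a ∈ 𝕀_1` on the `i`-th factor. -/
def tprodMap (Mi : Fin n → ModN K 1) (i : Fin n) (a : In K 1) :
    (⨂[K] j, (Mi j).carrier) →ₗ[K] ⨂[K] j, (Mi j).carrier :=
  PiTensorProduct.map (Function.update
    (fun j => (LinearMap.id : (Mi j).carrier →ₗ[K] (Mi j).carrier)) i
    (DistribMulAction.toLinearMap K ((Mi i).carrier) a))

/-- The `𝕀_n`-module `M` "is" the tensor product `M_1 ⊗ ⋯ ⊗ M_n` of the `𝕀_1`-modules `M_i`: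
there is a `K`-linear isomorphism under which the generators `x_i, ∂_i, ∫_i` of `𝕀_n` act on
the `i`-th tensor factor via the corresponding generators of `𝕀_1`. -/
def RealizesTensor (Mi : Fin n → ModN K 1) (M : Type*) [AddCommGroup M] [Module K M]
    [Module (In K n) M] [IsScalarTower K (In K n) M] : Prop :=
  ∃ φ : M ≃ₗ[K] ⨂[K] j, (Mi j).carrier,
    ∀ (i : Fin n) (m : M),
      φ (xEl K n i • m) = tprodMap K n Mi i (xEl K 1 0) (φ m) ∧
      φ (dEl K n i • m) = tprodMap K n Mi i (dEl K 1 0) (φ m) ∧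
      φ (intEl K n i • m) = tprodMap K n Mi i (intEl K 1 0) (φ m)

/-- `M` is (isomorphic to) the simple weight module `M(𝒟_Ω)` attached to the orbit of `λ`
and the subset `𝒟 ⊆ 𝔻_Ω`: the tensor product of copies of `K[x]` (for `i ∈ 𝒟`) and of
`M(1, λ_i)` (for `i ∉ 𝒟`). -/
def RealizesMD (lam : Fin n → K) (D : Set (Fin n)) (M : Type*) [AddCommGroup M] [Module K M]
    [Module (In K n) M] [IsScalarTower K (In K n) M] : Prop :=
  ∃ Mi : Fin n → ModN K 1,
    (∀ i, i ∈ D → Nonempty ((Mi i).carrier ≃ₗ[In K 1] P K 1)) ∧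
    (∀ i, i ∉ D → Nonempty ((Mi i).carrier ≃ₗ[In K 1] Msl K 1 (lam i))) ∧
    RealizesTensor K n Mi M

/-- `M` is (isomorphic to) the module `P_{n-1} ⊗ M(s, λ)` (with the copy of `M(s,λ)` placed
in position `j`). -/
def RealizesPMs (lam : Fin n → K) (j : Fin n) (s : ℕ) (M : Type*) [AddCommGroup M] [Module K M]
    [Module (In K n) M] [IsScalarTower K (In K n) M] : Prop :=
  ∃ Mi : Fin n → ModN K 1,
    (∀ i, i ≠ j → Nonempty ((Mi i).carrier ≃ₗ[In K 1] P K 1)) ∧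
    Nonempty ((Mi j).carrier ≃ₗ[In K 1] Msl K s (lam j)) ∧
    RealizesTensor K n Mi M

/-- Membership in the category `GW(𝕀_n, 𝒟_Ω)`: generalized weight modules with support in the
orbit of `λ` all of whose simple subquotients are isomorphic to `M(𝒟_Ω)`. -/
def InGWD (lam : Fin n → K) (D : Set (Fin n)) (M : Type*) [AddCommGroup M] [Module K M]
    [Module (In K n) M] [IsScalarTower K (In K n) M] : Prop :=
  IsGenWeightModule K n M ∧ supp K n M ⊆ orbitOf K n lam ∧
  ∀ (p q : Submodule (In K n) M), p ≤ q →
    IsSimpleModule (In K n) (q ⧸ Submodule.comap q.subtype p) →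
    RealizesMD K n lam D (q ⧸ Submodule.comap q.subtype p)

/-- The support `S(𝒟_Ω) = ℕ_+^{𝒟_Ω} × ∏_{i ∉ 𝒟_Ω} (λ_i + ℤ)` of the module `M(𝒟_Ω)`. -/
def SuppMD (lam : Fin n → K) (D : Set (Fin n)) : Set (Fin n → K) :=
  {mu | (∀ i ∈ D, ∃ m : ℕ, 0 < m ∧ mu i = (m : K)) ∧
        (∀ i ∉ D, ∃ z : ℤ, mu i = lam i + (z : K))}

/-- `M` is an absolutely prime `𝕀_n`-module: its annihilator is a prime ideal and every
nonzero subfactor of `M` has the same annihilator. -/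
def IsAbsolutelyPrime (M : Type*) [AddCommGroup M] [Module K M]
    [Module (In K n) M] [IsScalarTower K (In K n) M] : Prop :=
  IsPrimeSet K n (annSet K n M) ∧
  ∀ (p q : Submodule (In K n) M), p ≤ q →
    Nontrivial (q ⧸ Submodule.comap q.subtype p) →
    annSet K n (q ⧸ Submodule.comap q.subtype p) = annSet K n M


-- the commutative subalgebra D_n = K[H_1, …, H_n]
lemma xEl_smul (i : Fin n) (p : P K n) : xEl K n i • p = MvPolynomial.X i * p := rfl

lemma dEl_smul (i : Fin n) (p : P K n) : dEl K n i • p = MvPolynomial.pderiv i p := rfl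

lemma hEl_monomial (i : Fin n) (α : Fin n →₀ ℕ) (c : K) :
    HEl K n i • (MvPolynomial.monomial α c : P K n)
      = (((α i : ℕ) : K) + 1) • MvPolynomial.monomial α c := by
  have hx : xEl K n i • (MvPolynomial.monomial α c : P K n)
      = MvPolynomial.monomial (α + Finsupp.single i 1) c := by
    rw [xEl_smul, MvPolynomial.X, MvPolynomial.monomial_mul, one_mul, add_comm]
  rw [HEl, mul_smul, hx, dEl_smul, MvPolynomial.pderiv_monomial,
    add_tsub_cancel_right, MvPolynomial.smul_monomial, Finsupp.add_apply,
    Finsupp.single_eq_same, smul_eq_mul]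
  congr 1
  push_cast
  ring

private lemma In_ext {a b : In K n} (h : ∀ p : P K n, a • p = b • p) : a = b := by
  have : (show InSub K n from a) = (show InSub K n from b) :=
    Subtype.ext (LinearMap.ext fun p => h p)
  exact this

lemma hEl_comm (i j : Fin n) : HEl K n i * HEl K n j = HEl K n j * HEl K n i := by
  apply In_ext
  intro p
  induction p using MvPolynomial.induction_on' with
  | monomial α c =>
      have key : ∀ a b : Fin n, (HEl K n a * HEl K n b) • (MvPolynomial.monomial α c : P K n)
          = ((((α b : ℕ) : K) + 1) * (((α a : ℕ) : K) + 1)) • MvPolynomial.monomial α c := by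
        intro a b
        rw [mul_smul, hEl_monomial, ← smul_comm, hEl_monomial, smul_smul]
      rw [key, key, mul_comm]
  | add p q hp hq =>
      rw [smul_add, smul_add, hp, hq]

/-- `D_n = K[H_1, …, H_n]` as a subalgebra of `𝕀_n`. -/
def DnSub : Subalgebra K (In K n) := Algebra.adjoin K (Set.range (HEl K n))

/-- The commutative algebra `D_n` (as a type). -/
def Dn : Type _ := DnSub K n

instance : CommRing (Dn K n) :=
  Algebra.adjoinCommRingOfComm K (by rintro a ⟨i, rfl⟩ b ⟨j, rfl⟩; exact hEl_comm K n i j)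

instance : Algebra K (Dn K n) := inferInstanceAs (Algebra K (DnSub K n))

/-- The inclusion `D_n → 𝕀_n`. -/
def dnVal : Dn K n →+* In K n := ((DnSub K n).val : DnSub K n →ₐ[K] In K n).toRingHom

/-- `H_i` as an element of `D_n`. -/
def HElD (i : Fin n) : Dn K n :=
  show DnSub K n from ⟨HEl K n i, Algebra.subset_adjoin ⟨i, rfl⟩⟩

lemma dn_comm (d : Dn K n) (i : Fin n) :
    dnVal K n d * HEl K n i = HEl K n i * dnVal K n d := by
  have h1 : DnSub K n ≤ Subalgebra.centralizer K (Set.range (HEl K n)) := by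
    apply Algebra.adjoin_le
    rintro x ⟨j, rfl⟩
    rw [SetLike.mem_coe, Subalgebra.mem_centralizer_iff]
    rintro g ⟨i', rfl⟩
    exact hEl_comm K n i' j
  have h2 := (Subalgebra.mem_centralizer_iff K).mp
    (h1 (show DnSub K n from d).2) (HEl K n i) ⟨i, rfl⟩
  exact h2.symm


section DnModules

variable (M : Type*) [AddCommGroup M] [Module K M] [Module (In K n) M]
  [IsScalarTower K (In K n) M]

lemma genWS_stable (lam : Fin n → K) {m : M} (hm : m ∈ genWeightSpace K n M lam)
    (d : Dn K n) : dnVal K n d • m ∈ genWeightSpace K n M lam := by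
  obtain ⟨N, hN⟩ := hm
  refine ⟨N, fun i => ?_⟩
  have hc : Commute (dnVal K n d) ((HEl K n i - algebraMap K (In K n) (lam i)) ^ N) := by
    apply Commute.pow_right
    exact Commute.sub_right (dn_comm K n d i) ((Algebra.commutes (lam i) (dnVal K n d)).symm)
  rw [← mul_smul, ← hc.eq, mul_smul, hN i, smul_zero]

instance genWS_smul (lam : Fin n → K) : SMul (Dn K n) (genWeightSpace K n M lam) :=
  ⟨fun d w => ⟨dnVal K n d • (w : M), genWS_stable K n M lam w.2 d⟩⟩

instance genWS_module (lam : Fin n → K) : Module (Dn K n) (genWeightSpace K n M lam) :=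
  Module.ofMinimalAxioms
    (fun d x y => Subtype.ext (smul_add (dnVal K n d) (x : M) (y : M)))
    (fun d d' x => Subtype.ext (show dnVal K n (d + d') • (x : M)
      = dnVal K n d • (x : M) + dnVal K n d' • (x : M) by rw [map_add, add_smul]))
    (fun d d' x => Subtype.ext (show dnVal K n (d * d') • (x : M)
      = dnVal K n d • (dnVal K n d' • (x : M)) by rw [map_mul, mul_smul]))
    (fun x => Subtype.ext (show dnVal K n 1 • (x : M) = (x : M) by rw [map_one, one_smul]))

instance genWS_tower (lam : Fin n → K) :
    IsScalarTower K (Dn K n) (genWeightSpace K n M lam) :=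
  ⟨fun c d w => Subtype.ext (show dnVal K n (c • d) • (w : M) = c • (dnVal K n d • (w : M)) by
    rw [show dnVal K n (c • d) = c • dnVal K n d from map_smul (DnSub K n).val c d, smul_assoc])⟩

end DnModules

/-- The maximal ideal `𝔪_λ = (H_1 − λ_1, …, H_n − λ_n)` of `D_n`. -/
def mIdeal (lam : Fin n → K) : Ideal (Dn K n) :=
  Ideal.span {d | ∃ i, d = HElD K n i - algebraMap K (Dn K n) (lam i)}

/-- The category `LF_𝔪(D_n)` of `𝔪_λ`-locally finite `D_n`-modules: every cyclic submodule is
finite dimensional over `K` and annihilated by a power of `𝔪_λ`. -/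
def IsLF (lam : Fin n → K) (N : Type*) [AddCommGroup N] [Module K N] [Module (Dn K n) N]
    [IsScalarTower K (Dn K n) N] : Prop :=
  ∀ x : N, FiniteDimensional K ((Submodule.span (Dn K n) {x}).restrictScalars K) ∧
    ∃ s : ℕ, ∀ i, ((HElD K n i - algebraMap K (Dn K n) (lam i)) ^ s) • x = 0

-- the algebra B_n = 𝕀_n/𝔞_n
/-- The maximal ideal `𝔞_n = 𝔭_1 + ⋯ + 𝔭_n` of `𝕀_n`. -/
def aFull : TwoSidedIdeal (In K n) := aIdeal K n Set.univ

/-- The skew Laurent polynomial algebra `B_n = 𝕀_n/𝔞_n`. -/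
def Bn : Type _ := (aFull K n).ringCon.Quotient

instance : Ring (Bn K n) := inferInstanceAs (Ring (aFull K n).ringCon.Quotient)

/-- The quotient map `𝕀_n → B_n`. -/
def toBn : In K n →+* Bn K n := RingCon.mk' _

lemma toBn_surjective : Function.Surjective (toBn K n) :=
  Quotient.mk''_surjective

/-- The composite `D_n → 𝕀_n → B_n`. -/
def bnD : Dn K n →+* Bn K n := (toBn K n).comp (dnVal K n)

/-- `B_n` as a right `D_n`-module (written as a left module structure, `d • b = b ⬝ d`). -/
instance : SMul (Dn K n) (Bn K n) := ⟨fun d b => b * bnD K n d⟩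

instance : Module (Dn K n) (Bn K n) :=
  Module.ofMinimalAxioms
    (fun d x y => show (x + y) * bnD K n d = x * bnD K n d + y * bnD K n d from add_mul _ _ _)
    (fun d d' x => show x * bnD K n (d + d') = x * bnD K n d + x * bnD K n d' by
      rw [map_add, mul_add])
    (fun d d' x => show x * bnD K n (d * d') = (x * bnD K n d') * bnD K n d by
      rw [mul_comm d d', map_mul, ← mul_assoc])
    (fun x => show x * bnD K n 1 = x by rw [map_one, mul_one])

instance : SMulCommClass (Dn K n) (Bn K n) (Bn K n) :=
  ⟨fun d b m => show (b * m) * bnD K n d = b * (m * bnD K n d) from mul_assoc b m (bnD K n d)⟩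

/-- The induced module `B_n ⊗_{D_n} N` of a `D_n`-module `N`. -/
def Ind (N : Type*) [AddCommGroup N] [Module (Dn K n) N] : Type _ :=
  (Bn K n) ⊗[Dn K n] N

section Ind

variable (N : Type*) [AddCommGroup N] [Module (Dn K n) N]

instance : AddCommGroup (Ind K n N) :=
  inferInstanceAs (AddCommGroup ((Bn K n) ⊗[Dn K n] N))

instance indModuleBn : Module (Bn K n) (Ind K n N) :=
  inferInstanceAs (Module (Bn K n) ((Bn K n) ⊗[Dn K n] N))

instance indModuleDn : Module (Dn K n) (Ind K n N) :=
  inferInstanceAs (Module (Dn K n) ((Bn K n) ⊗[Dn K n] N))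

instance indModuleIn : Module (In K n) (Ind K n N) := Module.compHom _ (toBn K n)

instance indModuleK : Module K (Ind K n N) := Module.compHom _ (algebraMap K (Dn K n))

lemma bn_algebraMap_comm (c : K) (u : Bn K n) :
    toBn K n (algebraMap K (In K n) c) * u = u * toBn K n (algebraMap K (In K n) c) := by
  obtain ⟨r, rfl⟩ := toBn_surjective K n u
  rw [← map_mul, ← map_mul, Algebra.commutes]

lemma dnVal_algebraMap (c : K) :
    dnVal K n (algebraMap K (Dn K n) c) = algebraMap K (In K n) c :=
  AlgHom.commutes (DnSub K n).val c

lemma ind_key (c : K) (w : (Bn K n) ⊗[Dn K n] N) :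
    (toBn K n (algebraMap K (In K n) c)) • w = (algebraMap K (Dn K n) c) • w := by
  induction w using TensorProduct.induction_on with
  | zero => rw [smul_zero, smul_zero]
  | tmul b x =>
      rw [TensorProduct.smul_tmul', TensorProduct.smul_tmul']
      congr 1
      show toBn K n (algebraMap K (In K n) c) * b = b * bnD K n (algebraMap K (Dn K n) c)
      have h1 : bnD K n (algebraMap K (Dn K n) c) = toBn K n (algebraMap K (In K n) c) := by
        show toBn K n (dnVal K n (algebraMap K (Dn K n) c)) = _
        rw [dnVal_algebraMap]
      rw [h1, bn_algebraMap_comm]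
  | add x y hx hy => rw [smul_add, smul_add, hx, hy]

instance indTower : IsScalarTower K (In K n) (Ind K n N) := by
  constructor
  intro c a v
  show toBn K n (c • a) • v = algebraMap K (Dn K n) c • ((toBn K n a : Bn K n) • v)
  rw [Algebra.smul_def, map_mul, mul_smul]
  exact ind_key K n N c _

end Ind


section BnQuot

variable (J : Submodule (Bn K n) (Bn K n))

instance : Module (In K n) (Bn K n ⧸ J) := Module.compHom _ (toBn K n)

instance : Module K (Bn K n ⧸ J) :=
  Module.compHom _ ((toBn K n).comp (algebraMap K (In K n)))

instance : IsScalarTower K (In K n) (Bn K n ⧸ J) := by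
  constructor
  intro c a v
  show toBn K n (c • a) • v = (toBn K n (algebraMap K (In K n) c)) • (toBn K n a • v)
  rw [Algebra.smul_def, map_mul, mul_smul]

end BnQuot

/-- The `𝕀_n`-module `M` "is" the tensor product `A ⊗ B` of an `𝕀_m`-module `A` and an
`𝕀_{n-m}`-module `B`: there is a `K`-linear isomorphism under which the generators of `𝕀_n`
with index `< m` act on the first factor (via the corresponding generators of `𝕀_m`) and the
remaining generators act on the second factor (via the generators of `𝕀_{n-m}`). -/
def RealizesSplit (m : ℕ) (A : Type*) [AddCommGroup A] [Module K A] [Module (In K m) A]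
    [IsScalarTower K (In K m) A]
    (B : Type*) [AddCommGroup B] [Module K B] [Module (In K (n - m)) B]
    [IsScalarTower K (In K (n - m)) B]
    (M : Type*) [AddCommGroup M] [Module K M] [Module (In K n) M]
    [IsScalarTower K (In K n) M] : Prop :=
  ∃ φ : M ≃ₗ[K] A ⊗[K] B,
    (∀ (i : Fin n) (hi : (i : ℕ) < m) (v : M),
      φ (xEl K n i • v) = LinearMap.rTensor B
        (DistribMulAction.toLinearMap K A (xEl K m ⟨i, hi⟩)) (φ v) ∧
      φ (dEl K n i • v) = LinearMap.rTensor B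
        (DistribMulAction.toLinearMap K A (dEl K m ⟨i, hi⟩)) (φ v) ∧
      φ (intEl K n i • v) = LinearMap.rTensor B
        (DistribMulAction.toLinearMap K A (intEl K m ⟨i, hi⟩)) (φ v)) ∧
    (∀ (i : Fin n) (hi : m ≤ (i : ℕ)) (v : M),
      φ (xEl K n i • v) = LinearMap.lTensor A
        (DistribMulAction.toLinearMap K B (xEl K (n - m) ⟨(i : ℕ) - m, by omega⟩)) (φ v) ∧
      φ (dEl K n i • v) = LinearMap.lTensor A
        (DistribMulAction.toLinearMap K B (dEl K (n - m) ⟨(i : ℕ) - m, by omega⟩)) (φ v) ∧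
      φ (intEl K n i • v) = LinearMap.lTensor A
        (DistribMulAction.toLinearMap K B (intEl K (n - m) ⟨(i : ℕ) - m, by omega⟩)) (φ v))

end



section Proof

lemma aux_ext (K : Type*) [Field K] [CharZero K] (n : ℕ) {a b : In K n}
    (h : ∀ (α : Fin n →₀ ℕ) (c : K), a • (MvPolynomial.monomial α c : P K n)
      = b • (MvPolynomial.monomial α c : P K n)) : a = b := by
  apply In_ext
  intro p
  induction p using MvPolynomial.induction_on' with
  | monomial α c => exact h α c
  | add p q hp hq => rw [smul_add, smul_add, hp, hq]

variable {K : Type*} [Field K] [CharZero K] {n : ℕ}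

lemma aux_d (i : Fin n) (α : Fin n →₀ ℕ) (c : K) :
    dEl K n i • (MvPolynomial.monomial α c : P K n)
      = MvPolynomial.monomial (α - Finsupp.single i 1) (c * (α i : K)) := by
  rw [dEl_smul, MvPolynomial.pderiv_monomial]

lemma aux_int (i : Fin n) (α : Fin n →₀ ℕ) (c : K) :
    intEl K n i • (MvPolynomial.monomial α c : P K n)
      = MvPolynomial.monomial (α + Finsupp.single i 1) (c * ((α i : K) + 1)⁻¹) := by
  have h : intEl K n i • (MvPolynomial.monomial α c : P K n)
      = intOp K n i (MvPolynomial.monomial α c) := rfl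
  have h2 : (MvPolynomial.monomial α c : P K n)
      = c • (MvPolynomial.basisMonomials (Fin n) K) α := by
    simp [MvPolynomial.smul_monomial]
  rw [h, h2, map_smul, intOp, Module.Basis.constr_basis, smul_smul, MvPolynomial.smul_monomial]
  simp

lemma aux_H (i : Fin n) (α : Fin n →₀ ℕ) (c : K) :
    HEl K n i • (MvPolynomial.monomial α c : P K n)
      = MvPolynomial.monomial α (c * ((α i : K) + 1)) := by
  rw [hEl_monomial, MvPolynomial.smul_monomial, smul_eq_mul, mul_comm]

lemma aux_x (i : Fin n) (α : Fin n →₀ ℕ) (c : K) :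
    xEl K n i • (MvPolynomial.monomial α c : P K n)
      = MvPolynomial.monomial (α + Finsupp.single i 1) c := by
  rw [xEl_smul, MvPolynomial.X, MvPolynomial.monomial_mul, one_mul, add_comm]

lemma aux_ne (k : ℕ) : (k : K) + 1 ≠ 0 := Nat.cast_add_one_ne_zero k

lemma rel_di (i : Fin n) : dEl K n i * intEl K n i = 1 := by
  apply aux_ext
  intro α c
  rw [mul_smul, aux_int, aux_d, one_smul, add_tsub_cancel_right]
  congr 1
  have := aux_ne (K := K) (α i)
  simp only [Finsupp.add_apply, Finsupp.single_eq_same]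
  push_cast
  field_simp

lemma rel_x (i : Fin n) : xEl K n i = intEl K n i * HEl K n i := by
  apply aux_ext
  intro α c
  rw [mul_smul, aux_H, aux_int, aux_x]
  congr 1
  have := aux_ne (K := K) (α i)
  field_simp

lemma rel_Hi (i : Fin n) : HEl K n i * intEl K n i = intEl K n i * (HEl K n i + 1) := by
  apply aux_ext
  intro α c
  rw [mul_smul, mul_smul, add_smul, smul_add, aux_int, one_smul, aux_H, aux_H, aux_int, aux_int,
    ← map_add]
  congr 1
  simp only [Finsupp.add_apply, Finsupp.single_eq_same]
  push_cast
  ring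

lemma rel_Hd (i : Fin n) : HEl K n i * dEl K n i = dEl K n i * (HEl K n i - 1) := by
  apply aux_ext
  intro α c
  rw [mul_smul, mul_smul, sub_smul, smul_sub, aux_d, one_smul, aux_H, aux_H, aux_d, aux_d,
    ← map_sub]
  congr 1
  simp only [Finsupp.tsub_apply, Finsupp.single_eq_same]
  rcases Nat.eq_zero_or_pos (α i) with h | h
  · simp [h]
  · rw [Nat.cast_sub h]; push_cast; ring

lemma rel_He (i : Fin n) : HEl K n i * (1 - intEl K n i * dEl K n i)
    = 1 - intEl K n i * dEl K n i := by
  apply aux_ext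
  intro α c
  rw [mul_smul, sub_smul, one_smul, mul_smul, aux_d, aux_int, smul_sub, aux_H, aux_H]
  rcases Nat.eq_zero_or_pos (α i) with h | h
  · simp [h]
  · have e : α - Finsupp.single i 1 + Finsupp.single i 1 = α := by
      ext j
      by_cases hj : i = j
      · subst hj; simp; omega
      · simp [hj]
    rw [e, ← map_sub, ← map_sub]
    congr 1
    simp only [Finsupp.tsub_apply, Finsupp.single_eq_same]
    rw [Nat.cast_sub h]
    have : (α i : K) ≠ 0 := Nat.cast_ne_zero.mpr h.ne'
    rw [Nat.cast_one, sub_add_cancel]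
    field_simp
    ring

lemma com_dd (i j : Fin n) : Commute (dEl K n i) (dEl K n j) := by
  by_cases hij : i = j
  · subst hij; exact Commute.refl _
  apply aux_ext
  intro α c
  rw [mul_smul, mul_smul, aux_d, aux_d, aux_d, aux_d]
  have e : α - Finsupp.single j 1 - Finsupp.single i 1
      = α - Finsupp.single i 1 - Finsupp.single j 1 := by
    ext k; simp only [Finsupp.tsub_apply]; omega
  rw [e]; congr 1
  simp [hij, Ne.symm hij]; ring

lemma com_ii (i j : Fin n) : Commute (intEl K n i) (intEl K n j) := by
  by_cases hij : i = j
  · subst hij; exact Commute.refl _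
  apply aux_ext
  intro α c
  rw [mul_smul, mul_smul, aux_int, aux_int, aux_int, aux_int]
  have e : α + Finsupp.single j 1 + Finsupp.single i 1
      = α + Finsupp.single i 1 + Finsupp.single j 1 := by
    ext k; simp only [Finsupp.add_apply]; omega
  rw [e]; congr 1
  simp [hij, Ne.symm hij]; ring

lemma com_di {i j : Fin n} (hij : i ≠ j) : Commute (dEl K n i) (intEl K n j) := by
  apply aux_ext
  intro α c
  rw [mul_smul, mul_smul, aux_d, aux_int, aux_d, aux_int]
  have e : α + Finsupp.single j 1 - Finsupp.single i 1
      = α - Finsupp.single i 1 + Finsupp.single j 1 := by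
    ext k; simp only [Finsupp.add_apply, Finsupp.tsub_apply, Finsupp.single_apply]
    split_ifs with h1 h2
    · exact absurd (h2.trans h1.symm) hij
    all_goals omega
  rw [e]; congr 1
  simp [hij, Ne.symm hij]; ring

lemma com_Hd {i j : Fin n} (hij : i ≠ j) : Commute (HEl K n i) (dEl K n j) := by
  apply aux_ext
  intro α c
  rw [mul_smul, mul_smul, aux_d, aux_H, aux_H, aux_d]
  congr 1
  simp [hij, Ne.symm hij]; ring

lemma com_Hi {i j : Fin n} (hij : i ≠ j) : Commute (HEl K n i) (intEl K n j) := by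
  apply aux_ext
  intro α c
  rw [mul_smul, mul_smul, aux_int, aux_H, aux_H, aux_int]
  congr 1
  simp [hij, Ne.symm hij]; ring

/-- shift by `z` in direction `i` -/
noncomputable def Sh (K : Type*) [Field K] [CharZero K] {n : ℕ} (i : Fin n) (z : ℤ) : In K n :=
  intEl K n i ^ z.toNat * dEl K n i ^ (-z).toNat

lemma Sh_nat (i : Fin n) (k : ℕ) : Sh K i (k : ℤ) = intEl K n i ^ k := by simp [Sh]

lemma Sh_neg (i : Fin n) (k : ℕ) : Sh K i (-(k : ℤ)) = dEl K n i ^ k := by simp [Sh]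

/-- an element commuting with the `i`-th integration and derivative -/
def CommI (i : Fin n) (a : In K n) : Prop := Commute a (dEl K n i) ∧ Commute a (intEl K n i)

lemma CommI.Sh {i : Fin n} {a : In K n} (h : CommI i a) (z : ℤ) : Commute a (Sh K i z) :=
  (h.2.pow_right _).mul_right (h.1.pow_right _)

lemma commI_d {i j : Fin n} (hij : i ≠ j) : CommI j (dEl K n i) := ⟨com_dd i j, com_di hij⟩
lemma commI_i {i j : Fin n} (hij : i ≠ j) : CommI j (intEl K n i) :=
  ⟨(com_di hij.symm).symm, com_ii i j⟩
lemma commI_H {i j : Fin n} (hij : i ≠ j) : CommI j (HEl K n i) := ⟨com_Hd hij, com_Hi hij⟩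

lemma com_Sh {i j : Fin n} (hij : i ≠ j) (z w : ℤ) : Commute (Sh K i z) (Sh K j w) :=
  ((((commI_i hij).Sh w).symm.pow_right _).mul_right (((commI_d hij).Sh w).symm.pow_right _)).symm

lemma rel_dik (i : Fin n) (k : ℕ) : dEl K n i ^ k * intEl K n i ^ k = 1 := by
  induction k with
  | zero => simp
  | succ k ih =>
    rw [pow_succ, pow_succ', mul_assoc, ← mul_assoc (dEl K n i) (intEl K n i), rel_di, one_mul, ih]

lemma rel_Hik (i : Fin n) (k : ℕ) :
    HEl K n i * intEl K n i ^ k = intEl K n i ^ k * (HEl K n i + k) := by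
  induction k with
  | zero => simp
  | succ k ih =>
    rw [pow_succ, ← mul_assoc, ih, mul_assoc, add_mul, rel_Hi, (Nat.cast_commute k _).eq,
      ← mul_add, ← mul_assoc]
    congr 1; push_cast; abel

lemma rel_Hdk (i : Fin n) (k : ℕ) :
    HEl K n i * dEl K n i ^ k = dEl K n i ^ k * (HEl K n i - k) := by
  induction k with
  | zero => simp
  | succ k ih =>
    rw [pow_succ, ← mul_assoc, ih, mul_assoc, sub_mul, rel_Hd, (Nat.cast_commute k _).eq,
      ← mul_sub, ← mul_assoc]
    congr 1; push_cast; abel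

lemma rel_HSh (i : Fin n) (z : ℤ) : HEl K n i * Sh K i z = Sh K i z * (HEl K n i + z) := by
  obtain ⟨k, rfl | rfl⟩ := z.eq_nat_or_neg
  · rw [Sh_nat, rel_Hik]; push_cast; rfl
  · rw [Sh_neg, rel_Hdk]; push_cast; rw [sub_eq_add_neg]

lemma rel_dSh (i : Fin n) (z : ℤ) : dEl K n i * Sh K i z = Sh K i (z - 1) := by
  obtain ⟨k, rfl | rfl⟩ := z.eq_nat_or_neg
  · cases k with
    | zero => rw [Sh_nat, show ((0 : ℕ) : ℤ) - 1 = -((1 : ℕ) : ℤ) by simp, Sh_neg]; simp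
    | succ k =>
      rw [Sh_nat, show ((k + 1 : ℕ) : ℤ) - 1 = (k : ℤ) by simp, Sh_nat, pow_succ', ← mul_assoc,
        rel_di, one_mul]
  · rw [Sh_neg, show -(k : ℤ) - 1 = -((k + 1 : ℕ) : ℤ) by push_cast; ring, Sh_neg, pow_succ']

section Mods

variable {M : Type*} [AddCommGroup M] [Module K M] [Module (In K n) M] [IsScalarTower K (In K n) M]

/-- purity in direction `i` -/
def Pure (K : Type*) [Field K] [CharZero K] {n : ℕ} {M : Type*} [AddCommGroup M]
    [Module (In K n) M] (i : Fin n) (v : M) : Prop :=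
  ∀ k : ℕ, intEl K n i • dEl K n i ^ (k + 1) • v = dEl K n i ^ k • v ∨ dEl K n i ^ (k + 1) • v = 0

lemma Pure.smul {i : Fin n} {v : M} (h : Pure K i v) {a : In K n} (ha : CommI i a) :
    Pure K i (a • v) := by
  intro k
  have e : ∀ k : ℕ, dEl K n i ^ k • a • v = a • dEl K n i ^ k • v := by
    intro k; rw [← mul_smul, ← mul_smul, (ha.1.pow_right k).eq]
  rw [e, e]
  rcases h k with h | h
  · left; rw [← h, ← mul_smul, ← mul_smul a, ha.2.eq]
  · right; rw [h, smul_zero]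

lemma int_Sh_smul {i : Fin n} {v : M} (h : Pure K i v) (z : ℤ) :
    intEl K n i • Sh K i z • v = Sh K i (z + 1) • v ∨ Sh K i z • v = 0 := by
  obtain ⟨k, rfl | rfl⟩ := z.eq_nat_or_neg
  · left
    rw [Sh_nat, show (k : ℤ) + 1 = ((k + 1 : ℕ) : ℤ) by simp, Sh_nat, pow_succ', mul_smul]
  · cases k with
    | zero =>
      left
      rw [show (-((0 : ℕ) : ℤ)) + 1 = ((1 : ℕ) : ℤ) by simp, Sh_nat, Sh_neg]; simp
    | succ k =>
      rw [Sh_neg, show (-((k + 1 : ℕ) : ℤ)) + 1 = -(k : ℤ) by push_cast; ring, Sh_neg]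
      exact h k

lemma rev_Sh_smul {i : Fin n} {v : M} (h : Pure K i v) (z : ℤ) :
    Sh K i (-z) • Sh K i z • v = v ∨ Sh K i z • v = 0 := by
  obtain ⟨k, rfl | rfl⟩ := z.eq_nat_or_neg
  · left; rw [Sh_nat, Sh_neg, ← mul_smul, rel_dik, one_smul]
  · rw [neg_neg, Sh_nat, Sh_neg]
    induction k with
    | zero => left; simp
    | succ k ih =>
      rcases h k with h | h
      · rcases ih with ih | ih
        · left; rw [pow_succ, mul_smul, h, ih]
        · right; rw [pow_succ', mul_smul, ih, smul_zero]
      · exact Or.inr h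

lemma sh_pair (s : Finset (Fin n)) (z : Fin n → ℤ) :
    (s : Set (Fin n)).Pairwise (Function.onFun Commute fun i => Sh K i (z i)) :=
  fun _ _ _ _ h => com_Sh h _ _

/-- multi-shift over a finite set of directions -/
noncomputable def FF (K : Type*) [Field K] [CharZero K] {n : ℕ} (s : Finset (Fin n))
    (z : Fin n → ℤ) : In K n :=
  s.noncommProd (fun i => Sh K i (z i)) (sh_pair s z)

lemma FF_left (i : Fin n) (z : Fin n → ℤ) :
    FF K Finset.univ z = Sh K i (z i) * FF K (Finset.univ.erase i) z :=
  (Finset.mul_noncommProd_erase Finset.univ (Finset.mem_univ i)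
    (fun i => Sh K i (z i)) (sh_pair _ z)).symm

lemma FF_right (i : Fin n) (z : Fin n → ℤ) :
    FF K Finset.univ z = FF K (Finset.univ.erase i) z * Sh K i (z i) :=
  (Finset.noncommProd_erase_mul Finset.univ (Finset.mem_univ i)
    (fun i => Sh K i (z i)) (sh_pair _ z)).symm

lemma FF_comm (i : Fin n) (z : Fin n → ℤ) {a : In K n} (h : ∀ j, i ≠ j → CommI j a) :
    Commute a (FF K (Finset.univ.erase i) z) :=
  Finset.noncommProd_commute _ _ _ _ fun j hj => (h j (Finset.ne_of_mem_erase hj).symm).Sh _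

lemma FF_update (i : Fin n) (z : Fin n → ℤ) (c : ℤ) :
    FF K (Finset.univ.erase i) (Function.update z i c) = FF K (Finset.univ.erase i) z := by
  unfold FF
  refine Finset.noncommProd_congr rfl (fun j hj => ?_) _
  rw [Function.update_of_ne (Finset.ne_of_mem_erase hj)]

lemma FF_d (i : Fin n) (z : Fin n → ℤ) :
    dEl K n i * FF K Finset.univ z = FF K Finset.univ (Function.update z i (z i - 1)) := by
  rw [FF_left i, FF_left i, FF_update, ← mul_assoc, rel_dSh, Function.update_self]

lemma FF_i (i : Fin n) (z : Fin n → ℤ) {v : M} (h : Pure K i v) :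
    intEl K n i • FF K Finset.univ z • v = FF K Finset.univ (Function.update z i (z i + 1)) • v
      ∨ FF K Finset.univ z • v = 0 := by
  rw [FF_right i, FF_right i, FF_update, Function.update_self, mul_smul, mul_smul,
    ← mul_smul (intEl K n i), (FF_comm i z fun j hj => commI_i hj).eq, mul_smul]
  rcases int_Sh_smul h (z i) with h | h
  · left; rw [h]
  · right; rw [h, smul_zero]

lemma FF_H (i : Fin n) (z : Fin n → ℤ) :
    HEl K n i * FF K Finset.univ z = FF K Finset.univ z * (HEl K n i + (z i : ℤ)) := by
  rw [FF_right i, ← mul_assoc, (FF_comm i z fun j hj => commI_H hj).eq, mul_assoc, rel_HSh,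
    mul_assoc]

lemma FF_zero (s : Finset (Fin n)) : FF K s (fun _ => (0 : ℤ)) = 1 := by
  unfold FF
  refine Finset.noncommProd_induction _ _ _ (fun a => a = 1) ?_ rfl ?_
  · rintro a b rfl rfl; simp
  · intro i _; simp [Sh]

lemma FF_rev (z : Fin n → ℤ) {v : M} (h : ∀ i : Fin n, Pure K i v) :
    FF K Finset.univ (fun i => - z i) • FF K Finset.univ z • v = v
      ∨ FF K Finset.univ z • v = 0 := by
  by_cases hz : ∃ i, Sh K i (z i) • v = 0
  · obtain ⟨i, hi⟩ := hz
    right; rw [FF_right i, mul_smul, hi, smul_zero]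
  · push Not at hz
    left
    rw [← mul_smul]
    unfold FF
    rw [← Finset.noncommProd_mul_distrib _ _ (sh_pair _ fun i => - z i) (sh_pair _ z)
      (fun i _ j _ hij => com_Sh hij _ _)]
    refine Finset.noncommProd_induction _ _ _ (fun a => a • v = v) ?_ (one_smul _ _) ?_
    · intro a b ha hb; rw [mul_smul, hb, ha]
    · intro i _
      rw [Pi.mul_apply, mul_smul]
      exact (rev_Sh_smul (h i) (z i)).resolve_right (hz i)

lemma FF_weight {lam : Fin n → K} {v : M} (hv : v ∈ weightSpace K n M lam) (z : Fin n → ℤ) :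
    FF K Finset.univ z • v ∈ weightSpace K n M (fun i => lam i + (z i : K)) := by
  intro i
  have e : ((z i : ℤ) : In K n) • v = (z i : K) • v := by
    rw [Int.cast_smul_eq_zsmul, Int.cast_smul_eq_zsmul]
  rw [← mul_smul, FF_H, mul_smul, add_smul, hv i, e, ← add_smul, smul_comm]

lemma separate (M : Type*) [AddCommGroup M] [Module K M] [Module (In K n) M]
    [IsScalarTower K (In K n) M] (lam : Fin n → K) (s : Finset (Fin n → K)) :
    lam ∉ s → ∃ a : In K n, (∀ m ∈ weightSpace K n M lam, a • m = m) ∧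
      ∀ mu ∈ s, ∀ m ∈ weightSpace K n M mu, a • m = 0 := by
  classical
  induction s using Finset.induction_on with
  | empty => intro _; exact ⟨1, fun m _ => one_smul _ m, by simp⟩
  | insert mu s hmu ih =>
    intro hl
    rw [Finset.mem_insert, not_or] at hl
    obtain ⟨a, ha, ha'⟩ := ih hl.2
    obtain ⟨i, hi⟩ := Function.ne_iff.mp hl.1
    have hi' : lam i - mu i ≠ 0 := sub_ne_zero.mpr hi
    have key : ∀ nu : Fin n → K, ∀ m ∈ weightSpace K n M nu,
        ((lam i - mu i)⁻¹ • (HEl K n i - algebraMap K _ (mu i))) • m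
          = ((lam i - mu i)⁻¹ * (nu i - mu i)) • m := by
      intro nu m hm
      rw [smul_assoc, sub_smul, hm i, algebraMap_smul, ← sub_smul, smul_smul]
    refine ⟨a * ((lam i - mu i)⁻¹ • (HEl K n i - algebraMap K _ (mu i))), ?_, ?_⟩
    · intro m hm
      rw [mul_smul, key _ m hm, inv_mul_cancel₀ hi', one_smul, ha m hm]
    · intro nu hnu m hm
      rw [mul_smul, key _ m hm]
      rcases Finset.mem_insert.mp hnu with rfl | h
      · simp
      · rw [smul_comm, ha' nu h m hm, smul_zero]

lemma weight_indep : iSupIndep (fun lam : Fin n → K => weightSpace K n M lam) := by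
  classical
  rw [iSupIndep_def]
  intro lam
  rw [Submodule.disjoint_def]
  intro u hu hu'
  rw [Submodule.mem_iSup_iff_exists_finsupp] at hu'
  obtain ⟨f, hf, rfl⟩ := hu'
  obtain ⟨a, ha, ha'⟩ := separate M lam (f.support.erase lam) (by simp)
  rw [← ha _ hu, Finsupp.sum, Finset.smul_sum]
  refine Finset.sum_eq_zero fun mu hmu => ?_
  have h := hf mu
  by_cases e : mu = lam
  · subst e; simp at h; rw [h, smul_zero]
  · simp only [ne_eq, e, not_false_eq_true, iSup_pos] at h
    exact ha' mu (Finset.mem_erase.mpr ⟨e, hmu⟩) _ h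

lemma weight_top (hM : IsWeightModule K n M) : (⨆ lam, weightSpace K n M lam) = ⊤ := by
  let _ := Classical.decEq (Fin n → K)
  exact DirectSum.IsInternal.submodule_iSup_eq_top hM

lemma sub_weight (hM : IsWeightModule K n M) (N : Submodule (In K n) M) :
    IsWeightModule K n N := by
  let _ := Classical.decEq (Fin n → K)
  have htop := weight_top hM
  unfold IsWeightModule
  refine DirectSum.isInternal_submodule_of_iSupIndep_of_iSup_eq_top weight_indep ?_
  rw [eq_top_iff]
  rintro ⟨u, hu⟩ -
  have hu' : u ∈ (⨆ lam, weightSpace K n M lam) := htop ▸ Submodule.mem_top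
  rw [Submodule.mem_iSup_iff_exists_finsupp] at hu'
  obtain ⟨f, hf, hfu⟩ := hu'
  have hfN : ∀ mu, f mu ∈ N := by
    intro mu
    obtain ⟨a, ha, ha'⟩ := separate M mu (f.support.erase mu) (by simp)
    have : a • u = f mu := by
      rw [← hfu, Finsupp.sum, Finset.smul_sum, Finset.sum_eq_single mu]
      · exact ha _ (hf mu)
      · intro nu hnu hne
        exact ha' nu (Finset.mem_erase.mpr ⟨hne, hnu⟩) _ (hf nu)
      · intro h; rw [Finsupp.notMem_support_iff.mp h, smul_zero]
    rw [← this]; exact N.smul_mem a hu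
  have : (⟨u, hu⟩ : N) = ∑ mu ∈ f.support, ⟨f mu, hfN mu⟩ := by
    apply Subtype.ext
    refine hfu.symm.trans ?_
    rw [Finsupp.sum]
    simp
  rw [this]
  refine Submodule.sum_mem _ fun mu _ => Submodule.mem_iSup_of_mem mu ?_
  intro i
  exact Subtype.ext (hf mu i)

lemma span_stable (W : Submodule K M) (hd : ∀ i, ∀ u ∈ W, dEl K n i • u ∈ W)
    (hi : ∀ i, ∀ u ∈ W, intEl K n i • u ∈ W) (hH : ∀ i, ∀ u ∈ W, HEl K n i • u ∈ W)
    (a : In K n) : ∀ u ∈ W, a • u ∈ W := by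
  have key : ∀ (x : Module.End K (P K n)) (hx : x ∈ InSub K n),
      ∀ u ∈ W, (show In K n from (⟨x, hx⟩ : InSub K n)) • u ∈ W := by
    intro x hx
    refine Algebra.adjoin_induction (p := fun x hx =>
      ∀ u ∈ W, (show In K n from (⟨x, hx⟩ : InSub K n)) • u ∈ W) ?_ ?_ ?_ ?_ hx
    · rintro x ((⟨i, rfl⟩ | ⟨i, rfl⟩) | ⟨i, rfl⟩) u hu
      · change xEl K n i • u ∈ W
        rw [rel_x, mul_smul]
        exact hi i _ (hH i _ hu)
      · exact hd i u hu
      · exact hi i u hu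
    · intro r u hu
      change (algebraMap K (In K n) r) • u ∈ W
      rw [algebraMap_smul]
      exact W.smul_mem r hu
    · intro x y hx hy h1 h2 u hu
      change ((show In K n from (⟨x, hx⟩ : InSub K n)) + (show In K n from (⟨y, hy⟩ : InSub K n)))
        • u ∈ W
      rw [add_smul]
      exact W.add_mem (h1 u hu) (h2 u hu)
    · intro x y hx hy h1 h2 u hu
      change ((show In K n from (⟨x, hx⟩ : InSub K n)) * (show In K n from (⟨y, hy⟩ : InSub K n)))
        • u ∈ W
      rw [mul_smul]
      exact h1 _ (h2 u hu)
  exact key a.1 a.2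

lemma pure_span {lam : Fin n → K} {v : M} (hv : v ∈ weightSpace K n M lam)
    (h : ∀ i : Fin n, Pure K i v) (a : In K n) :
    a • v ∈ Submodule.span K (Set.range fun z : Fin n → ℤ => FF K Finset.univ z • v) := by
  set W := Submodule.span K (Set.range fun z : Fin n → ℤ => FF K Finset.univ z • v) with hW
  have lift : ∀ b : In K n, (∀ z : Fin n → ℤ, b • FF K Finset.univ z • v ∈ W) → ∀ u ∈ W, b • u ∈ W := by
    intro b hb u hu
    induction hu using Submodule.span_induction with
    | mem x hx => obtain ⟨z, rfl⟩ := hx; exact hb z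
    | zero => rw [smul_zero]; exact W.zero_mem
    | add x y _ _ h1 h2 => rw [smul_add]; exact W.add_mem h1 h2
    | smul c x _ h1 => rw [smul_comm]; exact W.smul_mem c h1
  have mem : ∀ z : Fin n → ℤ, FF K Finset.univ z • v ∈ W := fun z => Submodule.subset_span ⟨z, rfl⟩
  refine span_stable W (fun i => lift _ ?_) (fun i => lift _ ?_) (fun i => lift _ ?_) a v ?_
  · intro z; rw [← mul_smul, FF_d]; exact mem _
  · intro z
    rcases FF_i i z (h i) with h | h
    · rw [h]; exact mem _
    · rw [h, smul_zero]; exact W.zero_mem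
  · intro z
    rw [FF_weight hv z i]
    exact W.smul_mem _ (mem z)
  · have := mem (fun _ => 0)
    rwa [FF_zero, one_smul] at this

lemma pure_simple {lam : Fin n → K} {v : M} (hv : v ∈ weightSpace K n M lam)
    (h : ∀ i : Fin n, Pure K i v) (hv0 : v ≠ 0) :
    IsSimpleModule (In K n) (Submodule.span (In K n) {v}) := by
  classical
  rw [isSimpleModule_iff_isAtom]
  refine ⟨by simpa using hv0, fun p hp => ?_⟩
  by_contra hne
  obtain ⟨u, hu, hu0⟩ := Submodule.exists_mem_ne_zero_of_ne_bot hne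
  refine absurd hp.le (fun _ => not_le_of_gt hp ?_)
  rw [Submodule.span_singleton_le_iff_mem]
  obtain ⟨b, rfl⟩ := Submodule.mem_span_singleton.mp (hp.le hu)
  have hW := pure_span hv h b
  rw [Finsupp.mem_span_range_iff_exists_finsupp] at hW
  obtain ⟨c, hc⟩ := hW
  have : ∃ z ∈ c.support, c z • FF K Finset.univ z • v ≠ 0 := by
    by_contra hcon
    push Not at hcon
    exact hu0 (hc ▸ Finset.sum_eq_zero hcon)
  obtain ⟨z, hz, hz0⟩ := this
  let wt : (Fin n → ℤ) → (Fin n → K) := fun z i => lam i + (z i : K)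
  have wt_inj : ∀ z w, wt z = wt w → z = w := by
    intro z w e
    funext i
    have := congrFun e i
    simpa [wt] using this
  obtain ⟨a, ha, ha'⟩ := separate M (wt z) ((c.support.erase z).image wt) (by
    intro hm
    obtain ⟨w, hw, hwz⟩ := Finset.mem_image.mp hm
    exact (Finset.mem_erase.mp hw).1 (wt_inj _ _ hwz))
  have hau : a • b • v = c z • FF K Finset.univ z • v := by
    rw [← hc, Finsupp.sum, Finset.smul_sum, Finset.sum_eq_single z]
    · exact ha _ (Submodule.smul_mem _ _ (FF_weight hv z))
    · intro w hw hne
      exact ha' (wt w) (Finset.mem_image_of_mem _ (Finset.mem_erase.mpr ⟨hne, hw⟩)) _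
        (Submodule.smul_mem _ _ (FF_weight hv w))
    · intro h; exact absurd hz h
  have hcz : c z ≠ 0 := fun h => hz0 (by rw [h, zero_smul])
  have hF : FF K Finset.univ z • v ≠ 0 := fun h => hz0 (by rw [h, smul_zero])
  have hFp : FF K Finset.univ z • v ∈ p := by
    have e : FF K Finset.univ z • v = (algebraMap K (In K n) (c z)⁻¹) • a • b • v := by
      rw [hau, algebraMap_smul, inv_smul_smul₀ hcz]
    rw [e]
    exact p.smul_mem _ (p.smul_mem _ hu)
  have := (FF_rev z h).resolve_right hF
  rw [← this]
  exact p.smul_mem _ hFp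

lemma com_Hp (i : Fin n) : Commute (HEl K n i) (1 - intEl K n i * dEl K n i) := by
  refine (Commute.one_right _).sub_right ?_
  change _ * _ = _ * _
  rw [← mul_assoc, rel_Hi, mul_assoc, mul_assoc, add_mul, rel_Hd, one_mul, ← mul_add_one,
    sub_add_cancel]

lemma pure_of_ne {lam : Fin n → K} {v : M} (hv : v ∈ weightSpace K n M lam) (i : Fin n) (l : ℕ)
    (hl : lam i ≠ l + 1) : intEl K n i • dEl K n i ^ (l + 1) • v = dEl K n i ^ l • v := by
  set u := (1 - intEl K n i * dEl K n i) • dEl K n i ^ l • v with hu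
  have h1 : HEl K n i • u = u := by
    rw [hu, ← mul_smul, rel_He]
  have e : ((l : ℕ) : In K n) • v = (l : K) • v := by
    rw [Nat.cast_smul_eq_nsmul, Nat.cast_smul_eq_nsmul]
  have h2 : HEl K n i • u = (lam i - l) • u := by
    rw [hu, ← mul_smul, (com_Hp i).eq, mul_smul, ← mul_smul (HEl K n i), rel_Hdk, mul_smul,
      sub_smul (HEl K n i), hv i, e, ← sub_smul]
    rw [smul_comm _ (lam i - l) v, smul_comm _ (lam i - l)]
  have h3 : (lam i - l - 1) • u = 0 := by
    rw [sub_smul, ← h2, h1, one_smul, sub_self]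
  have h4 : u = 0 := by
    refine (smul_eq_zero.mp h3).resolve_left fun h => hl ?_
    linear_combination h
  rw [hu, sub_smul, one_smul, sub_eq_zero, mul_smul, ← mul_smul (dEl K n i), ← pow_succ'] at h4
  exact h4.symm

/-- diagonal matrix unit -/
noncomputable def ek (K : Type*) [Field K] [CharZero K] {n : ℕ} (i : Fin n) (k : ℕ) : In K n :=
  intEl K n i ^ k * ((1 - intEl K n i * dEl K n i) * dEl K n i ^ k)

lemma ek_commI {i j : Fin n} (hij : i ≠ j) (k : ℕ) : CommI j (ek K i k) := by
  have h1 := commI_d (K := K) hij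
  have h2 := commI_i (K := K) hij
  exact ⟨(h2.1.pow_left k).mul_left
      (((Commute.one_left _).sub_left (h2.1.mul_left h1.1)).mul_left (h1.1.pow_left k)),
    (h2.2.pow_left k).mul_left
      (((Commute.one_left _).sub_left (h2.2.mul_left h1.2)).mul_left (h1.2.pow_left k))⟩

lemma ek_H (i j : Fin n) (k : ℕ) : Commute (HEl K n j) (ek K i k) := by
  by_cases hij : j = i
  · subst hij
    have h : (HEl K n j + k) * dEl K n j ^ k = dEl K n j ^ k * HEl K n j := by
      rw [add_mul, rel_Hdk, (Nat.cast_commute k _).eq, ← mul_add, sub_add_cancel]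
    have h2 : Commute (HEl K n j + k) (1 - intEl K n j * dEl K n j) :=
      (com_Hp j).add_left (Nat.cast_commute k _)
    change _ * _ = _ * _
    unfold ek
    rw [← mul_assoc, rel_Hik, mul_assoc, ← mul_assoc (HEl K n j + k), h2.eq, mul_assoc, h]
    simp only [mul_assoc]
  · have h := commI_H (K := K) hij
    exact (h.2.pow_right k).mul_right
      (((Commute.one_right _).sub_right (h.2.mul_right h.1)).mul_right (h.1.pow_right k))

lemma d_ek (i : Fin n) (k : ℕ) :
    dEl K n i ^ k * ek K i k = (1 - intEl K n i * dEl K n i) * dEl K n i ^ k := by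
  rw [ek, ← mul_assoc, rel_dik, one_mul]

lemma d_p (i : Fin n) : dEl K n i * (1 - intEl K n i * dEl K n i) = 0 := by
  rw [mul_sub, mul_one, ← mul_assoc, rel_di, one_mul, sub_self]

lemma weight_smul {lam : Fin n → K} {v : M} (hv : v ∈ weightSpace K n M lam) {a : In K n}
    (ha : ∀ j, Commute (HEl K n j) a) : a • v ∈ weightSpace K n M lam := by
  intro j
  rw [← mul_smul, (ha j).eq, mul_smul, hv j, smul_comm]

lemma decomp (s : Finset (Fin n)) {lam : Fin n → K} {v : M} (hv : v ∈ weightSpace K n M lam) :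
    v ∈ AddSubmonoid.closure {w : M | w ∈ weightSpace K n M lam ∧ ∀ i ∈ s, Pure K i w} := by
  classical
  induction s using Finset.induction_on with
  | empty => exact AddSubmonoid.subset_closure ⟨hv, by simp⟩
  | insert i s his ih =>
    refine (AddSubmonoid.closure_le.mpr ?_) ih
    rintro w ⟨hw, hp⟩
    by_cases hk : ∃ k : ℕ, lam i = k + 1
    · obtain ⟨k, hk⟩ := hk
      have hne : ∀ l : ℕ, l ≠ k → lam i ≠ l + 1 := by
        intro l hl h
        rw [hk] at h
        exact hl (by exact_mod_cast (add_right_cancel h).symm)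
      have hw1 : ek K i k • w ∈ weightSpace K n M lam := weight_smul hw fun j => ek_H i j k
      have hw2 : (1 - ek K i k) • w ∈ weightSpace K n M lam :=
        weight_smul hw fun j => (Commute.one_right _).sub_right (ek_H i j k)
      have e : w = ek K i k • w + (1 - ek K i k) • w := by
        rw [← add_smul, add_sub_cancel, one_smul]
      rw [e]
      refine add_mem (AddSubmonoid.subset_closure ⟨hw1, ?_⟩)
        (AddSubmonoid.subset_closure ⟨hw2, ?_⟩)
      · intro j hj
        rcases Finset.mem_insert.mp hj with rfl | hj'
        · intro l
          by_cases hl : l = k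
          · right
            subst hl
            rw [← mul_smul, pow_succ', mul_assoc, d_ek, ← mul_assoc, d_p, zero_mul, zero_smul]
          · left; exact pure_of_ne hw1 _ l (hne l hl)
        · exact (hp j hj').smul (ek_commI (by rintro rfl; exact his hj') k)
      · intro j hj
        rcases Finset.mem_insert.mp hj with rfl | hj'
        · intro l
          left
          by_cases hl : l = k
          · subst hl
            have : (1 - intEl K n j * dEl K n j) * (dEl K n j ^ l * (1 - ek K j l)) = 0 := by
              rw [mul_sub, d_ek, mul_one, ← one_sub_mul, ← mul_assoc, sub_sub_cancel, sub_mul,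
                one_mul]
              rw [mul_assoc (intEl K n j), ← mul_assoc (dEl K n j) (intEl K n j), rel_di, one_mul,
                sub_self, zero_mul]
            have h2 : ((1 - intEl K n j * dEl K n j) * (dEl K n j ^ l * (1 - ek K j l))) • w = 0 := by
              rw [this, zero_smul]
            rw [mul_smul, mul_smul, sub_smul, one_smul, sub_eq_zero, mul_smul,
              ← mul_smul (dEl K n j), ← pow_succ'] at h2
            exact h2.symm
          · exact pure_of_ne hw2 _ l (hne l hl)
        · have hc := ek_commI (K := K) (show i ≠ j by rintro rfl; exact his hj') k
          exact (hp j hj').smul ⟨(Commute.one_left _).sub_left hc.1,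
            (Commute.one_left _).sub_left hc.2⟩
    · push Not at hk
      refine AddSubmonoid.subset_closure ⟨hw, fun j hj => ?_⟩
      rcases Finset.mem_insert.mp hj with rfl | hj'
      · exact fun l => Or.inl (pure_of_ne hw _ l (hk l))
      · exact hp j hj'

lemma weight_semisimple (hM : IsWeightModule K n M) : IsSemisimpleModule (In K n) M := by
  apply IsSemisimpleModule.of_sSup_simples_eq_top
  have htop := weight_top hM
  set T := sSup {m : Submodule (In K n) M | IsSimpleModule (In K n) m} with hT
  have h1 : ∀ lam, ∀ v ∈ weightSpace K n M lam, v ∈ T := by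
    intro lam v hv
    refine (AddSubmonoid.closure_le (S := T.toAddSubmonoid).mpr ?_) (decomp Finset.univ hv)
    rintro w ⟨hw, hp⟩
    by_cases h0 : w = 0
    · subst h0; exact T.zero_mem
    · have hs := pure_simple hw (fun i => hp i (Finset.mem_univ i)) h0
      have hle : Submodule.span (In K n) {w} ≤ T := le_sSup hs
      exact hle (Submodule.mem_span_singleton_self w)
  rw [eq_top_iff]
  rintro u -
  have hu' : u ∈ (⨆ lam, weightSpace K n M lam) := htop ▸ Submodule.mem_top
  rw [Submodule.mem_iSup_iff_exists_finsupp] at hu'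
  obtain ⟨f, hf, rfl⟩ := hu'
  exact T.sum_mem fun mu _ => h1 mu _ (hf mu)

end Mods

end Proof

/-- every weight `𝕀_n`-module is a direct sum of simple weight submodules;
the category of weight `𝕀_n`-modules is semisimple. -/
theorem statement7 (K : Type*) [Field K] [CharZero K] (n : ℕ)
    (M : Type*) [AddCommGroup M] [Module K M] [Module (In K n) M] [IsScalarTower K (In K n) M] (hM : IsWeightModule K n M) :
    ∃ S : Set (Submodule (In K n) M),
      (∀ N ∈ S, IsSimpleModule (In K n) N ∧ IsWeightModule K n N) ∧
      (letI := Classical.decEq S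
       DirectSum.IsInternal (fun N : S => (N : Submodule (In K n) M))) := by
  haveI := weight_semisimple hM
  obtain ⟨S, hind, hsup, hsimp⟩ :=
    IsSemisimpleModule.exists_sSupIndep_sSup_simples_eq_top (In K n) M
  refine ⟨S, fun N hN => ⟨hsimp N hN, sub_weight hM N⟩, ?_⟩
  letI := Classical.decEq S
  exact DirectSum.isInternal_submodule_of_iSupIndep_of_iSup_eq_top ((sSupIndep_iff S).mp hind)
    (by rw [← sSup_eq_iSup', hsup])

end IDO
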